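/- arXiv:1910.02997 — 4 statements merged into one kernel-verified Lean document; each statement's English description precedes it below -/
import Mathlib

section
/- Let X, Y and Z be distinct nodes in an MPDAG G = (V,E). Suppose p is an unshielded possibly causal path from X to Y in G and q is a causal path from Y to Z in G such that the only node that p and q have in common is Y. Then the concatenation p ⊕ q is a possibly causal path from X to Z in G. -/
open scoped Classical

noncomputable section

/-- A partially directed graph on node type `V`: directed (`dir`) and undirected (`undir`)
edges, with at most one edge between any two nodes. -/
structure PDG (V : Type) where
  dir : V → V → Prop
  undir : V → V → Prop
  undir_symm : ∀ a b, undir a b → undir b a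
  dir_irrefl : ∀ a, ¬ dir a a
  undir_irrefl : ∀ a, ¬ undir a a
  dir_asymm : ∀ a b, dir a b → ¬ dir b a
  dir_not_undir : ∀ a b, dir a b → ¬ undir a b

namespace PDG

variable {V : Type}

/-- Two nodes are adjacent if there is an edge between them. -/
def Adj (G : PDG V) (a b : V) : Prop := G.dir a b ∨ G.dir b a ∨ G.undir a b

/-- No directed cycles. -/
def Acyclic (G : PDG V) : Prop := ∀ a, ¬ Relation.TransGen G.dir a a

/-- A maximally oriented PDAG (MPDAG): a partially directed graph with no directed
cycles, in which none of the four configurations of Meek's orientation rules occurs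
as an induced subgraph. -/
structure IsMPDAG (G : PDG V) : Prop where
  acyclic : G.Acyclic
  meek1 : ∀ a b c, G.dir a b → G.undir b c → G.Adj a c
  meek2 : ∀ a b c, G.dir a b → G.dir b c → ¬ G.undir a c
  meek3 : ∀ i j k l, k ≠ l → G.undir i j → G.undir i k → G.undir i l →
      G.dir k j → G.dir l j → G.Adj k l
  meek4 : ∀ i j k l, G.undir i j → G.undir i k → G.undir i l →
      G.dir j l → G.dir l k → G.Adj j k

/-- A DAG: only directed edges, no directed cycles. -/
def IsDAG (G : PDG V) : Prop := (∀ a b, ¬ G.undir a b) ∧ G.Acyclic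

/-- `⟨a,b,c⟩` is an unshielded collider. -/
def UnshieldedCollider (G : PDG V) (a b c : V) : Prop :=
  a ≠ c ∧ G.dir a b ∧ G.dir c b ∧ ¬ G.Adj a c

/-- `D ∈ [G]` : `D` is a DAG represented by the MPDAG `G`: same adjacencies,
same unshielded colliders, containing every directed edge of `G`. -/
def InClassOf (D G : PDG V) : Prop :=
  IsDAG D ∧ (∀ a b, G.Adj a b ↔ D.Adj a b) ∧
    (∀ a b c, G.UnshieldedCollider a b c ↔ D.UnshieldedCollider a b c) ∧
    (∀ a b, G.dir a b → D.dir a b)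

/-- `p` is a path: a sequence of at least two distinct nodes in which every pair of
successive nodes is adjacent. -/
def IsPath (G : PDG V) (p : List V) : Prop :=
  2 ≤ p.length ∧ p.Nodup ∧ p.Chain' G.Adj

/-- `p` is a path from `a` to `b`. -/
def IsPathFrom (G : PDG V) (p : List V) (a b : V) : Prop :=
  G.IsPath p ∧ p.head? = some a ∧ p.getLast? = some b

/-- `p` is a possibly causal path: no edge `V_i ← V_j` with `i < j` is in `G`. -/
def PossiblyCausal (G : PDG V) (p : List V) : Prop :=
  G.IsPath p ∧ ∀ i j : Fin p.length, (i : ℕ) < (j : ℕ) → ¬ G.dir (p.get j) (p.get i)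

/-- `p` is a causal path: all edges directed towards the endpoint. -/
def IsCausal (G : PDG V) (p : List V) : Prop :=
  2 ≤ p.length ∧ p.Nodup ∧ p.Chain' G.dir

/-- `p` is an undirected path. -/
def IsUndirPath (G : PDG V) (p : List V) : Prop :=
  p ≠ [] ∧ p.Nodup ∧ p.Chain' G.undir

/-- `p` is unshielded: every two nodes at distance two on `p` are nonadjacent. -/
def Unshielded (G : PDG V) (p : List V) : Prop :=
  ∀ (i : ℕ) (h : i + 2 < p.length),
    ¬ G.Adj (p.get ⟨i, by omega⟩) (p.get ⟨i + 2, h⟩)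

/-- `p` is proper w.r.t. the node set `X` : only its first node is in `X`. -/
def ProperFrom (X : Finset V) (p : List V) : Prop :=
  (∃ a ∈ X, p.head? = some a) ∧ ∀ i : Fin p.length, 0 < (i : ℕ) → p.get i ∉ X

/-- the last node of `p` is in `Y`. -/
def EndsIn (Y : Finset V) (p : List V) : Prop := ∃ b ∈ Y, p.getLast? = some b

/-- `p` starts with an undirected edge. -/
def StartsUndirected (G : PDG V) (p : List V) : Prop :=
  ∃ a b l, p = a :: b :: l ∧ G.undir a b

/-- There is no proper possibly causal path from `X` to `Y` in `G` that starts with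
an undirected edge. -/
def NoProperPCUndirStart (G : PDG V) (X Y : Finset V) : Prop :=
  ¬ ∃ p, G.PossiblyCausal p ∧ ProperFrom X p ∧ EndsIn Y p ∧ G.StartsUndirected p

/-- `A` is an undirected connected node set in `G`: every two distinct nodes of `A`
are joined by an undirected path in `G`. -/
def UndirConnected (G : PDG V) (A : Finset V) : Prop :=
  ∀ a ∈ A, ∀ b ∈ A, a ≠ b →
    ∃ p, G.IsUndirPath p ∧ p.head? = some a ∧ p.getLast? = some b

/-- `B` is a bucket in `D`: a maximal undirected connected subset of `D` in `G`. -/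
def Bucket (G : PDG V) (B D : Finset V) : Prop :=
  B.Nonempty ∧ B ⊆ D ∧ G.UndirConnected B ∧
    ∀ B' : Finset V, B ⊆ B' → B' ⊆ D → G.UndirConnected B' → B' = B

section DecEq

variable [DecidableEq V]

/-- `Bs` lists the bucket decomposition of `D`: the listed sets are buckets in `D`,
pairwise disjoint, with union `D`. -/
def IsBucketDecompList (G : PDG V) (D : Finset V) (Bs : List (Finset V)) : Prop :=
  (∀ B ∈ Bs, G.Bucket B D) ∧ (Bs.Pairwise fun B B' => Disjoint B B') ∧
    Bs.foldr (· ∪ ·) ∅ = D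

end DecEq

/-- The listed node sets are totally ordered as a partial causal ordering in `G` :
every edge between an earlier set and a later one points towards the later one. -/
def OrderedDecomp (G : PDG V) (Bs : List (Finset V)) : Prop :=
  ∀ i j : Fin Bs.length, (i : ℕ) < (j : ℕ) →
    ∀ a ∈ Bs.get i, ∀ b ∈ Bs.get j, G.Adj a b → G.dir a b

/-- the node at (interior) position `i` of `p` is a collider on `p`. -/
def ColliderAt (G : PDG V) (p : List V) (i : ℕ) : Prop :=
  ∃ u v w, p[i-1]? = some u ∧ p[i]? = some v ∧ p[i+1]? = some w ∧
    1 ≤ i ∧ G.dir u v ∧ G.dir w v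

/-- the node at (interior) position `i` of `p` is a definite non-collider on `p`. -/
def DefNonColliderAt (G : PDG V) (p : List V) (i : ℕ) : Prop :=
  ∃ u v w, p[i-1]? = some u ∧ p[i]? = some v ∧ p[i+1]? = some w ∧ 1 ≤ i ∧
    (G.dir v u ∨ G.dir v w ∨ (G.undir u v ∧ G.undir v w ∧ ¬ G.Adj u w))

/-- `p` is a definite status path: every interior node is a collider or a definite
non-collider on `p`. -/
def DefiniteStatus (G : PDG V) (p : List V) : Prop :=
  ∀ i : ℕ, 1 ≤ i → i + 1 < p.length → G.ColliderAt p i ∨ G.DefNonColliderAt p i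

/-- `p` is d-connecting given `Z` (in a DAG): every non-collider on `p` is outside
`Z` and every collider on `p` has a descendant in `Z`. -/
def DConnGiven (G : PDG V) (Z : Finset V) (p : List V) : Prop :=
  (∀ i u, 1 ≤ i → i + 1 < p.length → p[i]? = some u → ¬ G.ColliderAt p i → u ∉ Z) ∧
  (∀ i u, G.ColliderAt p i → p[i]? = some u →
    ∃ z ∈ Z, Relation.ReflTransGen G.dir u z)

/-- `A` and `B` are d-separated given `Z` : no path between them is d-connecting
given `Z`. -/
def DSep (G : PDG V) (A B Z : Finset V) : Prop :=
  ∀ p a b, a ∈ A → b ∈ B → G.IsPathFrom p a b → ¬ G.DConnGiven Z p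

/-- `p` is d-connecting given `Z` (definite status version): every definite
non-collider on `p` is outside `Z` and every collider on `p` has a descendant in `Z`. -/
def DConnDS (G : PDG V) (Z : Finset V) (p : List V) : Prop :=
  (∀ i u, G.DefNonColliderAt p i → p[i]? = some u → u ∉ Z) ∧
  (∀ i u, G.ColliderAt p i → p[i]? = some u →
    ∃ z ∈ Z, Relation.ReflTransGen G.dir u z)

/-- `Z` blocks the (definite status) path `p`. -/
def Blocks (G : PDG V) (Z : Finset V) (p : List V) : Prop := ¬ G.DConnDS Z p

/-- `D_{X̄}` : remove all edges into `X`. -/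
def removeInto (D : PDG V) (X : Finset V) : PDG V where
  dir a b := D.dir a b ∧ b ∉ X
  undir := D.undir
  undir_symm := D.undir_symm
  dir_irrefl := fun a h => D.dir_irrefl a h.1
  undir_irrefl := D.undir_irrefl
  dir_asymm := fun a b h h' => D.dir_asymm a b h.1 h'.1
  dir_not_undir := fun a b h => D.dir_not_undir a b h.1

/-- `D_{X̲}` : remove all edges out of `X`. -/
def removeOutOf (D : PDG V) (X : Finset V) : PDG V where
  dir a b := D.dir a b ∧ a ∉ X
  undir := D.undir
  undir_symm := D.undir_symm
  dir_irrefl := fun a h => D.dir_irrefl a h.1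
  undir_irrefl := D.undir_irrefl
  dir_asymm := fun a b h h' => D.dir_asymm a b h.1 h'.1
  dir_not_undir := fun a b h => D.dir_not_undir a b h.1

/-- `w'` is a possible descendant of `w` in `G`. -/
def PossibleDesc (G : PDG V) (w w' : V) : Prop :=
  w = w' ∨ ∃ p, G.PossiblyCausal p ∧ p.head? = some w ∧ p.getLast? = some w'

section Fin

variable [Fintype V] [DecidableEq V]

/-- the parents of the node `v` in `G`. -/
def paFin (G : PDG V) (v : V) : Finset V := Finset.univ.filter fun u => G.dir u v

/-- `Pa(S, G)` : the parents of the node set `S` in `G`, excluding `S` itself. -/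
def PaFin (G : PDG V) (S : Finset V) : Finset V :=
  (Finset.univ.filter fun u => ∃ v ∈ S, G.dir u v) \ S

/-- `a` is an ancestor of `y` within the induced subgraph of `G` on `S`
(every node is an ancestor of itself). -/
def AncestorIn (G : PDG V) (S : Finset V) (a y : V) : Prop :=
  a ∈ S ∧ y ∈ S ∧ Relation.ReflTransGen (fun u v => G.dir u v ∧ u ∈ S ∧ v ∈ S) a y

/-- `An(Y, G_S)` : the ancestors of `Y` in the induced subgraph of `G` on `S`. -/
def AnIn (G : PDG V) (Y S : Finset V) : Finset V :=
  Finset.univ.filter fun a => ∃ y ∈ Y, G.AncestorIn S a y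

/-- `forb(X, Y, G)` for single nodes `X`, `Y` : all possible descendants of nodes
`W ≠ X` lying on a proper possibly causal path from `X` to `Y` in `G`. -/
def Forb (G : PDG V) (X Y : V) : Finset V :=
  Finset.univ.filter fun w' => ∃ w, w ≠ X ∧
    (∃ p, G.PossiblyCausal p ∧ p.head? = some X ∧ p.getLast? = some Y ∧ w ∈ p) ∧
    G.PossibleDesc w w'

end Fin

end PDG

section Density

open PDG

variable {V : Type} [Fintype V] [DecidableEq V] {Ω : Type} [Fintype Ω] [DecidableEq Ω]

/-- the marginal of `f` over the node set `S`, at the values given by `g`. -/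
def margin (f : (V → Ω) → ℝ) (S : Finset V) (g : V → Ω) : ℝ :=
  ∑ h : V → Ω, if ∀ v ∈ S, h v = g v then f h else 0

/-- the conditional density `f(a | b)` of `A` given `B`, at the values given by `g`. -/
def condOn (f : (V → Ω) → ℝ) (A B : Finset V) (g : V → Ω) : ℝ :=
  margin f (A ∪ B) g / margin f B g

/-- `f` is a strictly positive discrete density over `V`. -/
def IsPosDensity (f : (V → Ω) → ℝ) : Prop :=
  (∀ g, 0 < f g) ∧ ∑ g : V → Ω, f g = 1

/-- `f` is consistent with the DAG `D` : it factorizes according to `D`. -/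
def ConsistentWith (f : (V → Ω) → ℝ) (D : PDG V) : Prop :=
  ∀ g, f g = ∏ v : V, condOn f {v} (D.paFin v) g

/-- the interventional density obtained from `f` by truncated factorization with
respect to the DAG `D` under `do(X = x)`, evaluated at `g` (parent values in `X`
are taken in agreement with `x`). -/
def doDens (f : (V → Ω) → ℝ) (D : PDG V) (X : Finset V) (x : V → Ω) (g : V → Ω) : ℝ :=
  ∏ v ∈ Finset.univ \ X, condOn f {v} (D.paFin v) fun u => if u ∈ X then x u else g u

/-- `f(y | do(x))` : the marginal over `Y` of the interventional density obtained
from `f` by truncated factorization with respect to `D`. -/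
def doMargin (f : (V → Ω) → ℝ) (D : PDG V) (X : Finset V) (x : V → Ω)
    (Y : Finset V) (y : V → Ω) : ℝ :=
  ∑ g : V → Ω,
    if (∀ v ∈ X, g v = x v) ∧ (∀ v ∈ Y, g v = y v) then doDens f D X x g else 0

end Density

open PDG

/-- On an unshielded walk without backward edges, all edges after a directed one are directed. -/
theorem PDG.IsMPDAG.transGen_of_dir {V : Type} {G : PDG V} (hG : G.IsMPDAG) {n : ℕ} {v : ℕ → V}
    (adj : ∀ i < n, G.Adj (v i) (v (i + 1)))
    (unsh : ∀ i, i + 2 ≤ n → ¬ G.Adj (v i) (v (i + 2)))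
    (noback : ∀ i j, i < j → j ≤ n → ¬ G.dir (v j) (v i))
    {i : ℕ} (hi : i < n) (hd : G.dir (v i) (v (i + 1))) :
    Relation.TransGen G.dir (v i) (v n) := by
  have key : ∀ m, i + 1 + m ≤ n →
      G.dir (v (i + m)) (v (i + m + 1)) ∧ Relation.TransGen G.dir (v i) (v (i + m + 1)) := by
    intro m
    induction m with
    | zero => exact fun _ => ⟨hd, .single hd⟩
    | succ m ih =>
      intro hm
      obtain ⟨h₁, h₂⟩ := ih (by omega)
      have h₃ : G.dir (v (i + m + 1)) (v (i + m + 2)) := by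
        rcases adj (i + m + 1) (by omega) with h | h | h
        · exact h
        · exact (noback _ _ (by omega) (by omega) h).elim
        · exact (unsh (i + m) (by omega) (hG.meek1 _ _ _ h₁ h)).elim
      exact ⟨h₃, h₂.tail h₃⟩
  have h := (key (n - i - 1) (by omega)).2
  rwa [show i + (n - i - 1) + 1 = n by omega] at h

/-- The last node of an unshielded walk without backward edges is not an ancestor of the first. -/
theorem PDG.IsMPDAG.not_transGen_of_unshielded {V : Type} {G : PDG V} (hG : G.IsMPDAG) {y c : V}
    (hyc : Relation.TransGen G.dir y c) :
    ∀ (n : ℕ) (v : ℕ → V), v n = y → v 0 = c →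
      (∀ i < n, G.Adj (v i) (v (i + 1))) →
      (∀ i, i + 2 ≤ n → ¬ G.Adj (v i) (v (i + 2))) →
      (∀ i j, i < j → j ≤ n → ¬ G.dir (v j) (v i)) → False := by
  induction hyc with
  | single h =>
    rintro n v rfl rfl adj unsh noback
    rcases Nat.eq_zero_or_pos n with rfl | hn
    · exact G.dir_irrefl _ h
    · exact noback 0 n hn le_rfl h
  | @tail w c hyw hwc ih =>
    rintro n v rfl rfl adj unsh noback
    have next : ∀ i ≤ n, G.dir w (v i) → i < n ∧ G.undir (v i) (v (i + 1)) ∧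
        G.Adj w (v (i + 1)) ∧ ¬ G.dir (v (i + 1)) w := by
      intro i hi hw
      have hin : i < n := by
        rcases hi.lt_or_eq with h | rfl
        · exact h
        · exact (hG.acyclic _ (hyw.tail hw)).elim
      have hu : G.undir (v i) (v (i + 1)) := by
        rcases adj i hin with h | h | h
        · exact (hG.acyclic _ (((hG.transGen_of_dir adj unsh noback hin h).trans hyw).tail hw)).elim
        · exact (noback _ _ (Nat.lt_succ_self i) hin h).elim
        · exact h
      exact ⟨hin, hu, hG.meek1 _ _ _ hw hu,
        fun h => hG.meek2 _ _ _ h hw (G.undir_symm _ _ hu)⟩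
    obtain ⟨l, hln, hl, hlmax⟩ : ∃ l ≤ n, G.Adj w (v l) ∧
        ∀ m, l < m → m ≤ n → ¬ G.Adj w (v m) :=
      ⟨Nat.findGreatest (fun l => G.Adj w (v l)) n, Nat.findGreatest_le _,
        Nat.findGreatest_spec (P := fun l => G.Adj w (v l)) (Nat.zero_le n) (.inl hwc),
        fun _ h₁ h₂ => Nat.findGreatest_is_greatest h₁ h₂⟩
    rcases hl with h | h | h
    · obtain ⟨h₁, -, h₂, -⟩ := next l hln h
      exact hlmax _ (Nat.lt_succ_self l) h₁ h₂
    · obtain ⟨i, hil, hi, himax⟩ : ∃ i ≤ l, G.dir w (v i) ∧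
          ∀ m, i < m → m ≤ l → ¬ G.dir w (v m) :=
        ⟨Nat.findGreatest (fun i => G.dir w (v i)) l, Nat.findGreatest_le _,
          Nat.findGreatest_spec (P := fun i => G.dir w (v i)) (Nat.zero_le l) hwc,
          fun _ h₁ h₂ => Nat.findGreatest_is_greatest h₁ h₂⟩
      have hil' : i < l := hil.lt_of_ne fun e => G.dir_asymm _ _ h (e ▸ hi)
      obtain ⟨-, hu, ha, hnd⟩ := next i (hil.trans hln) hi
      have hwu : G.undir w (v (i + 1)) :=
        (ha.resolve_left (himax _ (Nat.lt_succ_self i) hil')).resolve_left hnd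
      have hne : i + 1 ≠ l := fun e => hnd (e ▸ h)
      rcases hG.meek1 _ _ _ h hwu with h' | h' | h'
      · exact noback _ _ (by omega) hln h'
      · exact hG.meek2 _ _ _ h' h (G.undir_symm _ _ hwu)
      · rcases hG.meek4 _ _ _ _ (G.undir_symm _ _ h') (G.undir_symm _ _ hu)
          (G.undir_symm _ _ hwu) h hi with k | k | k
        · exact noback _ _ hil' hln k
        · exact hG.acyclic _ (((Relation.TransGen.single k).tail h).tail hi)
        · exact hG.meek2 _ _ _ h hi k
    · refine ih (n - l + 1) (fun t => t.casesOn w fun t => v (l + t)) ?_ rfl ?_ ?_ ?_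
      · change v (l + (n - l)) = v n
        rw [Nat.add_sub_cancel' hln]
      · rintro (_ | i) hi
        · exact .inr (.inr h)
        · exact adj (l + i) (by omega)
      · rintro (_ | i) hi
        · exact hlmax (l + 1) (by omega) (by omega)
        · exact unsh (l + i) (by omega)
      · rintro (_ | i) (_ | j) hij hj
        · omega
        · intro hd
          rcases Nat.eq_zero_or_pos j with rfl | hj'
          · exact G.dir_not_undir _ _ hd (G.undir_symm _ _ h)
          · exact hlmax (l + j) (by omega) (by omega) (.inr (.inl hd))
        · omega
        · exact noback (l + i) (l + j) (by omega) (by omega)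

/-- The possible causality condition on a path, phrased through `List.Pairwise`. -/
theorem PDG.possiblyCausal_iff_pairwise {V : Type} {G : PDG V} {p : List V} :
    G.PossiblyCausal p ↔ G.IsPath p ∧ p.Pairwise fun a b => ¬ G.dir b a := by
  rw [PDG.PossiblyCausal, List.pairwise_iff_get]
  exact Iff.rfl

/-- concatenating an unshielded possibly causal path from `X` to `Y`
with a causal path from `Y` to `Z` meeting it only at `Y` yields a possibly causal
path from `X` to `Z`. -/
theorem stmt9 {V : Type} (G : PDG V) (hG : G.IsMPDAG)
    (X Y Z : V) (hXY : X ≠ Y) (hYZ : Y ≠ Z) (hXZ : X ≠ Z)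
    (p q : List V)
    (hp : G.PossiblyCausal p) (hpf : p.head? = some X) (hpl : p.getLast? = some Y)
    (hpu : G.Unshielded p)
    (hq : G.IsCausal q) (hqf : q.head? = some Y) (hql : q.getLast? = some Z)
    (hcom : ∀ v, v ∈ p → v ∈ q → v = Y) :
    G.PossiblyCausal (p ++ q.tail) ∧ (p ++ q.tail).head? = some X ∧
      (p ++ q.tail).getLast? = some Z := by
  obtain ⟨t, rfl⟩ : ∃ t, q = Y :: t := by
    cases q with
    | nil => simp at hqf
    | cons a t => exact ⟨t, by simpa using hqf⟩
  rw [List.tail_cons]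
  obtain ⟨⟨hlen, hnd, hch⟩, hpw⟩ := PDG.possiblyCausal_iff_pairwise.1 hp
  obtain ⟨hqlen, hqnd, hqch⟩ := hq
  have hpne : p ≠ [] := by rintro rfl; simp at hpf
  have htne : t ≠ [] := by rintro rfl; simp at hqlen
  have hqtr : (Y :: t).Pairwise (Relation.TransGen G.dir) :=
    List.isChain_iff_pairwise.1 (hqch.imp fun _ _ => .single)
  obtain ⟨hYt, httr⟩ := List.pairwise_cons.1 hqtr
  obtain ⟨hYnt, htnd⟩ := List.nodup_cons.1 hqnd
  have hcross : ∀ a ∈ p, ∀ b ∈ t, ¬ G.dir b a := by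
    intro a ha b hb hba
    obtain ⟨i, hi, rfl⟩ := List.getElem_of_mem ha
    have hv : ∀ m (hm : m < p.length), p.getD m Y = p[m] := fun m hm => by simp [hm]
    refine hG.not_transGen_of_unshielded ((hYt b hb).tail hba) (p.length - 1 - i)
      (fun m => p.getD (i + m) Y) ?_ (hv i hi) ?_ ?_ ?_
    · rw [Nat.add_sub_cancel' (by omega), hv _ (by omega)]
      rw [List.getLast?_eq_getElem?, List.getElem?_eq_getElem (by omega)] at hpl
      exact Option.some.inj hpl
    · intro m hm
      change G.Adj (p.getD (i + m) Y) (p.getD (i + m + 1) Y)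
      rw [hv _ (by omega), hv _ (by omega)]
      exact List.isChain_iff_getElem.1 hch _ _
    · intro m hm
      change ¬ G.Adj (p.getD (i + m) Y) (p.getD (i + m + 2) Y)
      rw [hv _ (by omega), hv _ (by omega)]
      exact hpu (i + m) (by omega)
    · intro m k hmk hk
      rw [hv _ (by omega), hv _ (by omega)]
      exact hp.2 ⟨i + m, by omega⟩ ⟨i + k, by omega⟩ (by simpa using hmk)
  refine ⟨PDG.possiblyCausal_iff_pairwise.2 ⟨⟨?_, ?_, ?_⟩, ?_⟩, ?_, ?_⟩
  · rw [List.length_append]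
    omega
  · refine List.nodup_append'.2 ⟨hnd, htnd, fun v hvp hvt => hYnt ?_⟩
    rwa [← hcom v hvp (List.mem_cons_of_mem _ hvt)]
  · refine List.isChain_append.2 ⟨hch, hqch.tail.imp fun _ _ => .inl, fun a ha b hb => ?_⟩
    obtain rfl : Y = a := by simpa [hpl] using ha
    exact .inl ((List.isChain_cons.1 hqch).1 b hb)
  · exact List.pairwise_append.2 ⟨hpw,
      httr.imp (S := fun a b => ¬ G.dir b a) fun h h' => hG.acyclic _ (h.tail h'), hcross⟩
  · rwa [List.head?_append_of_ne_nil _ hpne]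
  · rwa [List.getLast?_append_of_ne_nil _ htne, ← List.getLast?_cons_of_ne_nil htne]
end
end

section
/- Let X and Y be disjoint node sets in an MPDAG G = (V,E) and suppose there is no proper possibly causal path from X to Y in G that starts with an undirected edge. Let (B_1,…,B_k), k ≥ 1, be the bucket decomposition of An(Y, G_{V∖X}) ordered as a partial causal ordering in G. Then for every i ∈ {1,…,k} there is no proper possibly causal path from X to B_i in G that starts with an undirected edge. -/
open scoped Classical

noncomputable section

open PDG

namespace PDG

variable {V : Type}

/-- The possibly causal lists of nodes, with the one-node lists included. -/
def PossiblyCausalList (G : PDG V) (p : List V) : Prop :=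
  p.Pairwise (fun a b => a ≠ b ∧ ¬ G.dir b a) ∧ p.IsChain G.Adj

theorem possiblyCausal_iff (G : PDG V) (p : List V) :
    G.PossiblyCausal p ↔ 2 ≤ p.length ∧ G.PossiblyCausalList p := by
  unfold PossiblyCausal IsPath PossiblyCausalList
  rw [List.pairwise_and_iff, List.pairwise_iff_getElem (R := fun a b => ¬ G.dir b a)]
  constructor
  · rintro ⟨⟨h2, hn, hc⟩, hb⟩
    exact ⟨h2, ⟨hn, fun i j hi hj hij => hb ⟨i, hi⟩ ⟨j, hj⟩ hij⟩, hc⟩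
  · rintro ⟨h2, ⟨hn, hb⟩, hc⟩
    exact ⟨⟨h2, hn, hc⟩, fun i j hij => hb i j i.2 j.2 hij⟩

theorem properFrom_cons_iff (X : Finset V) (a : V) (l : List V) :
    ProperFrom X (a :: l) ↔ a ∈ X ∧ ∀ v ∈ l, v ∉ X := by
  unfold ProperFrom
  constructor
  · rintro ⟨⟨a', ha', h⟩, hl⟩
    obtain rfl : a = a' := by simpa using h
    refine ⟨ha', fun v hv => ?_⟩
    obtain ⟨i, hi, rfl⟩ := List.getElem_of_mem hv
    simpa using hl ⟨i + 1, by simpa using hi⟩ (Nat.succ_pos i)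
  · rintro ⟨ha, hl⟩
    refine ⟨⟨a, ha, rfl⟩, ?_⟩
    rintro ⟨_ | i, hi⟩ hpos
    · simp at hpos
    · exact hl _ (List.getElem_mem _)

namespace PossiblyCausalList

variable {G : PDG V}

theorem of_infix {p q : List V} (hp : G.PossiblyCausalList p) (h : q <:+: p) :
    G.PossiblyCausalList q :=
  ⟨hp.1.sublist h.sublist, hp.2.infix h⟩

/-- In an MPDAG, no directed walk leads from the last node of a possibly causal path
back to its first node. -/
theorem not_transGen_dir (hG : G.IsMPDAG) {p : List V} (hp : G.PossiblyCausalList p)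
    {a b : V} (ha : p.head? = some a) (hb : p.getLast? = some b) :
    ¬ Relation.TransGen G.dir b a := by
  induction hn : p.length using Nat.strong_induction_on generalizing p a b with
  | _ n ih =>
  intro hba
  induction hba generalizing p with
  | @single z hdir =>
    obtain _ | ⟨a', l⟩ := p
    · simp at ha
    obtain rfl : a' = z := by simpa using ha
    obtain rfl | hl := eq_or_ne l []
    · obtain rfl : a' = b := by simpa using hb
      exact G.dir_irrefl _ hdir
    · rw [List.getLast?_cons, List.getLast?_eq_some_getLast hl] at hb
      obtain rfl : l.getLast hl = b := by simpa using hb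
      exact ((List.pairwise_cons.1 hp.1).1 _ (List.getLast_mem hl)).2 hdir
  | @tail z a hbz hza ihz =>
    obtain _ | ⟨a', l⟩ := p
    · simp at ha
    obtain rfl : a' = a := by simpa using ha
    obtain _ | ⟨u, l⟩ := l
    · obtain rfl : a' = b := by simpa using hb
      exact hG.acyclic _ (hbz.tail hza)
    have hb' : (u :: l).getLast? = some b := by simpa using hb
    have hpw := List.pairwise_cons.1 hp.1
    have hch := List.isChain_cons_cons.1 hp.2
    have htl : G.PossiblyCausalList (u :: l) := ⟨hpw.2, hch.2⟩
    have shorten : ¬ Relation.TransGen G.dir b u :=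
      ih _ (by simp [← hn]) htl rfl hb' rfl
    have hau : G.undir a' u := by
      rcases hch.1 with h | h | h
      · exact (shorten ((hbz.tail hza).tail h)).elim
      · exact ((hpw.1 u (by simp)).2 h).elim
      · exact h
    have hzu : G.undir z u := by
      rcases hG.meek1 _ _ _ hza hau with h | h | h
      · exact (shorten (hbz.tail h)).elim
      · exact (hG.meek2 _ _ _ h hza (G.undir_symm _ _ hau)).elim
      · exact h
    refine ihz (p := z :: u :: l) ⟨List.pairwise_cons.2 ⟨fun w hw => ⟨?_, fun hwz => ?_⟩, hpw.2⟩,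
      List.isChain_cons_cons.2 ⟨Or.inr (Or.inr hzu), hch.2⟩⟩ rfl (by simpa using hb')
      (by simpa using hn)
    · rintro rfl
      exact (hpw.1 _ hw).2 hza
    · obtain rfl | hwl := List.mem_cons.1 hw
      · exact G.dir_not_undir _ _ hwz (G.undir_symm _ _ hzu)
      obtain ⟨s, t, rfl⟩ := List.append_of_mem hwl
      obtain _ | ⟨t₀, t⟩ := t
      · obtain rfl : w = b := by simpa [List.getLast?_cons, List.getLast?_append] using hb'
        have huw := (List.pairwise_cons.1 hpw.2).1 w hwl
        have hub : G.undir u w := by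
          rcases hG.meek1 _ _ _ hwz hzu with h | h | h
          · exact (huw.2 h).elim
          · exact (hG.meek2 _ _ _ h hwz (G.undir_symm _ _ hzu)).elim
          · exact G.undir_symm _ _ h
        rcases hG.meek4 u w a' z hub (G.undir_symm _ _ hau) (G.undir_symm _ _ hzu) hwz hza
          with h | h | h
        · exact (hpw.1 w hw).2 h
        · exact hG.acyclic a' (((Relation.TransGen.single h).tail hwz).tail hza)
        · exact hG.meek2 _ _ _ hwz hza h
      · refine ih (a' :: u :: (s ++ [w])).length ?_ (p := a' :: u :: (s ++ [w])) (a := a')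
          (b := w) ?_ rfl (by simp [List.getLast?_cons, List.getLast?_append]) rfl
          ((Relation.TransGen.single hwz).tail hza)
        · rw [← hn]; simp
        · exact hp.of_infix ⟨[], t₀ :: t, by simp⟩

/-- In an MPDAG, appending a directed edge to a possibly causal path yields a possibly
causal path. -/
theorem append_dir (hG : G.IsMPDAG) {p : List V} (hp : G.PossiblyCausalList p)
    {b c : V} (hb : p.getLast? = some b) (hbc : G.dir b c) :
    G.PossiblyCausalList (p ++ [c]) := by
  have key : ∀ v ∈ p, ¬ Relation.TransGen G.dir b v := by
    intro v hv
    obtain ⟨s, t, rfl⟩ := List.append_of_mem hv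
    exact (hp.of_infix (q := v :: t) ⟨s, [], by simp⟩).not_transGen_dir hG rfl
      (by simpa [List.getLast?_append, List.getLast?_cons] using hb)
  refine ⟨List.pairwise_append.2 ⟨hp.1, List.pairwise_singleton _ _, fun v hv w hw => ?_⟩,
    List.isChain_append.2 ⟨hp.2, List.isChain_singleton _, fun v hv w hw => ?_⟩⟩
  · obtain rfl : w = c := by simpa using hw
    refine ⟨?_, fun h => key v hv ((Relation.TransGen.single hbc).tail h)⟩
    rintro rfl
    exact key v hv (.single hbc)
  · obtain rfl : b = v := by simpa [hb] using hv
    obtain rfl : c = w := by simpa using hw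
    exact Or.inl hbc

end PossiblyCausalList

/-- A proper possibly causal path starting with an undirected edge extends along any
directed walk that avoids `X`. -/
theorem exists_properPossiblyCausal_of_reflTransGen {G : PDG V} (hG : G.IsMPDAG)
    {X S : Finset V} (hXS : Disjoint X S) {b y : V}
    (hby : Relation.ReflTransGen (fun u v => G.dir u v ∧ u ∈ S ∧ v ∈ S) b y)
    (hp : ∃ p, G.PossiblyCausal p ∧ ProperFrom X p ∧ p.getLast? = some b ∧
      G.StartsUndirected p) :
    ∃ p, G.PossiblyCausal p ∧ ProperFrom X p ∧ p.getLast? = some y ∧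
      G.StartsUndirected p := by
  induction hby with
  | refl => exact hp
  | @tail z c _ hzc ih =>
    obtain ⟨_, hpc, hprop, hlast, x, u, l, rfl, hxu⟩ := ih
    obtain ⟨hdir, _, hcS⟩ := hzc
    have hpr := (properFrom_cons_iff _ _ _).1 hprop
    refine ⟨x :: u :: (l ++ [c]), ?_, ?_, ?_, x, u, _, rfl, hxu⟩
    · exact (possiblyCausal_iff _ _).2 ⟨by simp,
        ((possiblyCausal_iff _ _).1 hpc).2.append_dir hG hlast hdir⟩
    · refine (properFrom_cons_iff _ _ _).2 ⟨hpr.1, fun v hv => ?_⟩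
      have hv' : v ∈ u :: l ∨ v = c := by
        simpa [or_assoc] using hv
      rcases hv' with h | rfl
      · exact hpr.2 v h
      · exact fun hX => Finset.disjoint_left.1 hXS hX hcS
    · simp [List.getLast?_cons, List.getLast?_append]

end PDG

/-- if there is no proper possibly causal path from `X` to `Y` starting
with an undirected edge, the same holds from `X` to each bucket `B_i` of
`An(Y, G_{V∖X})`. -/
theorem stmt10 {V : Type} [Fintype V] [DecidableEq V]
    (G : PDG V) (hG : G.IsMPDAG) (X Y : Finset V) (hXY : Disjoint X Y)
    (hno : G.NoProperPCUndirStart X Y)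
    (Bs : List (Finset V)) (hk : Bs ≠ [])
    (hdec : G.IsBucketDecompList (G.AnIn Y (Finset.univ \ X)) Bs)
    (hord : G.OrderedDecomp Bs) :
    ∀ i : Fin Bs.length, G.NoProperPCUndirStart X (Bs.get i) := by
  rintro i ⟨p, hpc, hprop, ⟨b, hb, hlast⟩, hstart⟩
  have hbA := (hdec.1 _ (List.get_mem Bs i)).2.1 hb
  obtain ⟨y, hy, -, -, hby⟩ := (Finset.mem_filter.1 hbA).2
  obtain ⟨q, hqc, hqprop, hqlast, hqstart⟩ :=
    exists_properPossiblyCausal_of_reflTransGen hG Finset.disjoint_sdiff hby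
      ⟨p, hpc, hprop, hlast, hstart⟩
  exact hno ⟨q, hqc, hqprop, ⟨y, hy, hqlast⟩, hqstart⟩
end
end

section
/- Let X and Y be disjoint node sets in an MPDAG G = (V,E) and suppose there is no proper possibly causal path from X to Y in G that starts with an undirected edge. Let (B_1,…,B_k), k ≥ 1, be the bucket decomposition of An(Y, G_{V∖X}) ordered as a partial causal ordering in G. For i ∈ {2,…,k}, let P_i = (∪_{j=1}^{i-1} B_j) ∩ Pa(B_i,G) and N_i = (∪_{j=1}^{i-1} B_j) ∖ Pa(B_i,G). Then for every DAG D in [G], B_i is d-separated from N_i given X ∪ P_i in the graph D_{X̄} obtained from D by removing all edges into X. -/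
open scoped Classical

noncomputable section

open PDG

namespace PDG

variable {V : Type}

/-- Two nodes lie in the same undirected component of `G`. -/
def UndirReach (G : PDG V) : V → V → Prop := Relation.ReflTransGen G.undir

lemma UndirReach.symm {G : PDG V} {a b : V} (h : G.UndirReach a b) : G.UndirReach b a := by
  induction h with
  | refl => exact .refl
  | tail _ hbc ih => exact .head (G.undir_symm _ _ hbc) ih

lemma UndirReach.trans {G : PDG V} {a b c : V} (h : G.UndirReach a b)
    (h' : G.UndirReach b c) : G.UndirReach a c :=
  Relation.ReflTransGen.trans h h'

lemma UndirReach.of_chain {G : PDG V} {a b : V} {p : List V} (h : p.IsChain G.undir)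
    (ha : p.head? = some a) (hb : p.getLast? = some b) : G.UndirReach a b := by
  induction p generalizing a with
  | nil => simp at ha
  | cons x l ih =>
    obtain rfl : x = a := by simpa using ha
    cases l with
    | nil =>
      obtain rfl : x = b := by simpa using hb
      exact .refl
    | cons y l =>
      rw [List.isChain_cons_cons] at h
      exact .head h.1 (ih h.2 rfl (by simpa using hb))

lemma UndirReach.exists_undirPath {G : PDG V} {a b : V} (h : G.UndirReach a b) :
    ∃ p, G.IsUndirPath p ∧ p.head? = some a ∧ p.getLast? = some b := by
  let H : SimpleGraph V :=
    { Adj := G.undir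
      symm := ⟨fun a b => G.undir_symm a b⟩
      loopless := ⟨G.undir_irrefl⟩ }
  have hr : H.Reachable a b := (SimpleGraph.reachable_iff_reflTransGen a b).2 h
  obtain ⟨w, hw⟩ := hr.exists_isPath
  refine ⟨w.support, ⟨w.support_ne_nil, hw.support_nodup, w.isChain_adj_support⟩, ?_, ?_⟩
  · rw [List.head?_eq_some_head w.support_ne_nil, w.head_support]
  · rw [List.getLast?_eq_some_getLast w.support_ne_nil, w.getLast_support]

lemma Bucket.undirReach {G : PDG V} {B A : Finset V} (hB : G.Bucket B A) {a b : V}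
    (ha : a ∈ B) (hb : b ∈ B) : G.UndirReach a b := by
  by_cases hab : a = b
  · exact hab ▸ .refl
  · obtain ⟨p, hp, h1, h2⟩ := hB.2.2.1 a ha b hb hab
    exact .of_chain hp.2.2 h1 h2

/-- A bucket in `A` is the intersection of `A` with an undirected component. -/
lemma Bucket.mem_of_undirReach {G : PDG V} {B A : Finset V} (hB : G.Bucket B A) {b c : V}
    (hb : b ∈ B) (hc : c ∈ A) (h : G.UndirReach b c) : c ∈ B := by
  rw [← hB.2.2.2 (A.filter (G.UndirReach b))
    (fun x hx => Finset.mem_filter.2 ⟨hB.2.1 hx, hB.undirReach hb hx⟩)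
    (Finset.filter_subset _ _)
    (fun x hx y hy _ => UndirReach.exists_undirPath
      ((Finset.mem_filter.1 hx).2.symm.trans (Finset.mem_filter.1 hy).2))]
  exact Finset.mem_filter.2 ⟨hc, h⟩

/-- In an MPDAG, a parent of a node in another undirected component is a parent of every node
of that component. -/
lemma IsMPDAG.dir_of_undirReach {G : PDG V} (hG : G.IsMPDAG) {a b c : V} (hab : G.dir a b)
    (hn : ¬ G.UndirReach a b) (h : G.UndirReach b c) : G.dir a c := by
  induction h with
  | refl => exact hab
  | @tail d c hbd hdc ih =>
    rcases hG.meek1 a d c ih hdc with h | h | h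
    · exact h
    · exact absurd (G.undir_symm _ _ hdc) (hG.meek2 c a d h ih)
    · exact absurd ((Relation.ReflTransGen.single h).trans
        (UndirReach.symm (Relation.ReflTransGen.tail hbd hdc))) hn

lemma InClassOf.dir_or_undir {D G : PDG V} (hD : D.InClassOf G) {a b : V} (h : D.dir a b) :
    G.dir a b ∨ G.undir a b := by
  rcases (hD.2.1 a b).2 (.inl h) with h' | h' | h'
  · exact .inl h'
  · exact absurd (hD.2.2.2 _ _ h') (D.dir_asymm _ _ h)
  · exact .inr h'

lemma InClassOf.dir_or_dir_of_adj_removeInto {D G : PDG V} (hD : D.InClassOf G) {X : Finset V}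
    {a b : V} (h : (D.removeInto X).Adj a b) :
    (D.removeInto X).dir a b ∨ (D.removeInto X).dir b a := by
  rcases h with h | h | h
  · exact .inl h
  · exact .inr h
  · exact absurd h (hD.1.1 a b)

lemma not_mem_of_reflTransGen_removeInto {D : PDG V} {X : Finset V} {u z : V} (hu : u ∉ X)
    (h : Relation.ReflTransGen (D.removeInto X).dir u z) : z ∉ X := by
  cases h with
  | refl => exact hu
  | tail _ h => exact h.2

lemma mem_AnIn_of_dir [Fintype V] [DecidableEq V] {G : PDG V} {X Y : Finset V} {u w : V}
    (hu : u ∉ X) (h : G.dir u w) (hw : w ∈ G.AnIn Y (Finset.univ \ X)) :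
    u ∈ G.AnIn Y (Finset.univ \ X) := by
  simp only [AnIn, Finset.mem_filter, Finset.mem_univ, true_and] at hw ⊢
  obtain ⟨y, hy, hwS, hyS, hr⟩ := hw
  have huS : u ∈ Finset.univ \ X := by simpa using hu
  exact ⟨y, hy, huS, hyS, .head ⟨h, huS, hwS⟩ hr⟩

lemma not_mem_of_mem_AnIn [Fintype V] [DecidableEq V] {G : PDG V} {X Y : Finset V} {u : V}
    (h : u ∈ G.AnIn Y (Finset.univ \ X)) : u ∉ X := by
  simp only [AnIn, Finset.mem_filter, Finset.mem_univ, true_and] at h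
  obtain ⟨y, hy, hwS, -⟩ := h
  simpa using hwS

lemma _root_.Finset.mem_foldr_union {α : Type*} [DecidableEq α] {l : List (Finset α)} {a : α} :
    a ∈ l.foldr (· ∪ ·) ∅ ↔ ∃ B ∈ l, a ∈ B := by
  induction l with
  | nil => simp
  | cons B l ih => simp [ih]

lemma _root_.Finset.mem_foldr_union_take {α : Type*} [DecidableEq α] {l : List (Finset α)}
    {n : ℕ} {a : α} :
    a ∈ (l.take n).foldr (· ∪ ·) ∅ ↔ ∃ j : Fin l.length, (j : ℕ) < n ∧ a ∈ l.get j := by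
  rw [Finset.mem_foldr_union]
  constructor
  · rintro ⟨B, hB, ha⟩
    obtain ⟨j, hj, rfl⟩ := List.mem_take_iff_getElem.1 hB
    exact ⟨⟨j, by omega⟩, (lt_min_iff.1 hj).1, ha⟩
  · rintro ⟨j, hj, ha⟩
    exact ⟨_, List.mem_take_iff_getElem.2 ⟨j, by omega, rfl⟩, ha⟩

lemma OrderedDecomp.le_of_dir {G : PDG V} {Bs : List (Finset V)}
    (hord : G.OrderedDecomp Bs) {j k : Fin Bs.length} {a b : V}
    (ha : a ∈ Bs.get j) (hb : b ∈ Bs.get k) (h : G.dir a b) : j ≤ k := by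
  by_contra! hlt
  exact G.dir_asymm _ _ h (hord k j hlt b hb a ha (.inr (.inl h)))

section BucketDecomp

variable [DecidableEq V] {G : PDG V} {A : Finset V} {Bs : List (Finset V)}

lemma IsBucketDecompList.exists_mem (hdec : G.IsBucketDecompList A Bs) {a : V} (ha : a ∈ A) :
    ∃ j : Fin Bs.length, a ∈ Bs.get j := by
  rw [← hdec.2.2, Finset.mem_foldr_union] at ha
  obtain ⟨B, hB, ha⟩ := ha
  obtain ⟨j, rfl⟩ := List.get_of_mem hB
  exact ⟨j, ha⟩

lemma IsBucketDecompList.bucket (hdec : G.IsBucketDecompList A Bs) (j : Fin Bs.length) :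
    G.Bucket (Bs.get j) A :=
  hdec.1 _ (List.get_mem _ _)

lemma IsBucketDecompList.eq_of_undirReach (hdec : G.IsBucketDecompList A Bs)
    {j k : Fin Bs.length} {a b : V} (ha : a ∈ Bs.get j) (hb : b ∈ Bs.get k)
    (h : G.UndirReach a b) : j = k := by
  have hb' := (hdec.bucket j).mem_of_undirReach ha ((hdec.bucket k).2.1 hb) h
  by_contra hne
  have hd : ∀ {j k : Fin Bs.length}, j < k → Disjoint (Bs.get j) (Bs.get k) :=
    fun hjk => List.pairwise_iff_get.1 hdec.2.1 _ _ hjk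
  rcases lt_or_gt_of_ne hne with hlt | hlt
  · exact Finset.disjoint_left.1 (hd hlt) hb' hb
  · exact Finset.disjoint_left.1 (hd hlt) hb hb'

/-- A causal path in `D_{X̄}` that starts outside `X` and ends in a bucket starts in the
undirected component of an earlier or the same bucket. -/
lemma exists_bucket_of_reflTransGen_removeInto [Fintype V] {X Y : Finset V} {D : PDG V}
    (hG : G.IsMPDAG) (hdec : G.IsBucketDecompList (G.AnIn Y (Finset.univ \ X)) Bs)
    (hord : G.OrderedDecomp Bs) (hD : D.InClassOf G) {u z : V} {j : Fin Bs.length}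
    (hz : z ∈ Bs.get j) (h : Relation.ReflTransGen (D.removeInto X).dir u z) (hu : u ∉ X) :
    ∃ k ≤ j, ∃ b ∈ Bs.get k, G.UndirReach u b := by
  induction h using Relation.ReflTransGen.head_induction_on with
  | refl => exact ⟨j, le_rfl, z, hz, .refl⟩
  | @head u w huw _ ih =>
    obtain ⟨k, hk, b, hb, hwb⟩ := ih huw.2
    by_cases hr : G.UndirReach u w
    · exact ⟨k, hk, b, hb, hr.trans hwb⟩
    · have hdir : G.dir u w :=
        (hD.dir_or_undir huw.1).resolve_right fun h => hr (.single h)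
      have hub := hG.dir_of_undirReach hdir hr hwb
      obtain ⟨m, hm⟩ :=
        hdec.exists_mem (mem_AnIn_of_dir hu hub ((hdec.bucket k).2.1 hb))
      exact ⟨m, (hord.le_of_dir hm hb hub).trans hk, u, hm, .refl⟩

end BucketDecomp

/-- Following a d-connecting path along a forward edge leads causally either to its last node
or to the conditioning set, in the latter case from a collider on the path. -/
lemma DConnGiven.exists_reflTransGen {H : PDG V} {Z : Finset V} {p : List V}
    (hp : H.DConnGiven Z p)
    (hadj : ∀ s (h : s + 1 < p.length), H.dir p[s] p[s + 1] ∨ H.dir p[s + 1] p[s])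
    {s : ℕ} (hs : s + 1 < p.length) (hdir : H.dir p[s] p[s + 1]) :
    ∃ z, Relation.ReflTransGen H.dir p[s + 1] z ∧ (z ∈ Z ∨ p.getLast? = some z) := by
  by_cases hlast : s + 2 < p.length
  · rcases hadj (s + 1) hlast with h | h
    · obtain ⟨z, hr, hz⟩ := hp.exists_reflTransGen hadj hlast h
      exact ⟨z, .head h hr, hz⟩
    · obtain ⟨z, hz, hr⟩ := hp.2 (s + 1) p[s + 1]
        ⟨p[s], p[s + 1], p[s + 2], by simp, by simp, by simp, by omega, hdir, h⟩ (by simp)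
      exact ⟨z, hr, .inl hz⟩
  · refine ⟨p[s + 1], .refl, .inr ?_⟩
    rw [List.getLast?_eq_getElem?, List.getElem?_eq_some_iff]
    exact ⟨by omega, by congr 1; omega⟩
termination_by p.length - s

end PDG

/-- `B_i` is d-separated from `N_i` given `X ∪ P_i` in `D_{X̄}`,
for every DAG `D` in `[G]`. -/
theorem stmt11 {V : Type} [Fintype V] [DecidableEq V]
    (G : PDG V) (hG : G.IsMPDAG) (X Y : Finset V) (hXY : Disjoint X Y)
    (hno : G.NoProperPCUndirStart X Y)
    (Bs : List (Finset V)) (hk : Bs ≠ [])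
    (hdec : G.IsBucketDecompList (G.AnIn Y (Finset.univ \ X)) Bs)
    (hord : G.OrderedDecomp Bs)
    (D : PDG V) (hD : D.InClassOf G)
    (i : Fin Bs.length) (hi : 1 ≤ (i : ℕ)) :
    (D.removeInto X).DSep (Bs.get i)
      (((Bs.take (i : ℕ)).foldr (· ∪ ·) ∅) \ G.PaFin (Bs.get i))
      (X ∪ (((Bs.take (i : ℕ)).foldr (· ∪ ·) ∅) ∩ G.PaFin (Bs.get i))) := by
  intro p a b ha hb hp hcon
  obtain ⟨⟨hlen, -, hchain⟩, hhead, hlast⟩ := hp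
  rw [Finset.mem_sdiff, Finset.mem_foldr_union_take] at hb
  obtain ⟨⟨j, hji, hbj⟩, hbPa⟩ := hb
  have hadj : ∀ s (h : s + 1 < p.length), (D.removeInto X).dir p[s] p[s + 1] ∨
      (D.removeInto X).dir p[s + 1] p[s] := fun s h =>
    hD.dir_or_dir_of_adj_removeInto (List.isChain_iff_getElem.1 hchain s h)
  have hp0 : p[0] = a := by
    rw [List.head?_eq_getElem?, List.getElem?_eq_some_iff] at hhead
    exact hhead.2
  have hpl : p[p.length - 1] = b := by
    rw [List.getLast?_eq_getElem?, List.getElem?_eq_some_iff] at hlast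
    exact hlast.2
  have haA := (hdec.bucket i).2.1 ha
  have hab : ¬ G.UndirReach a b := fun h =>
    absurd (hdec.eq_of_undirReach ha hbj h) (fun h => by subst h; omega)
  obtain ⟨r, hr, hin, hout⟩ : ∃ r, ∃ h : r + 1 < p.length,
      G.UndirReach a p[r] ∧ ¬ G.UndirReach a p[r + 1] := by
    by_contra! hcl
    have hall : ∀ r (h : r < p.length), G.UndirReach a p[r] := by
      intro r
      induction r with
      | zero => intro h; rw [hp0]; exact .refl
      | succ r ih => intro h; exact hcl r h (ih (by omega))
    exact hab (hpl ▸ hall (p.length - 1) (by omega))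
  have hout' : ¬ G.UndirReach p[r] p[r + 1] := fun h => hout (hin.trans h)
  rcases hadj r hr with hdir | hdir
  · have hrX : p[r] ∉ X := by
      rcases Nat.eq_zero_or_pos r with rfl | hpos
      · rw [hp0]; exact not_mem_of_mem_AnIn haA
      · refine fun hX => hcon.1 r p[r] hpos hr (by simp) ?_ (Finset.mem_union_left _ hX)
        rintro ⟨u, v, w, -, hv, hw, -, -, hwv⟩
        rw [List.getElem?_eq_some_iff] at hv hw
        obtain ⟨_, rfl⟩ := hv
        obtain ⟨_, rfl⟩ := hw
        exact (D.removeInto X).dir_asymm _ _ hdir hwv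
    obtain ⟨z, hrz, hz⟩ := hcon.exists_reflTransGen hadj hr hdir
    obtain ⟨l, hli, hzl⟩ : ∃ l : Fin Bs.length, (l : ℕ) < i ∧ z ∈ Bs.get l := by
      rcases hz with hz | hz
      · rcases Finset.mem_union.1 hz with hzX | hzP
        · exact absurd hzX (not_mem_of_reflTransGen_removeInto hdir.2 hrz)
        · exact Finset.mem_foldr_union_take.1 (Finset.mem_inter.1 hzP).1
      · obtain rfl : b = z := Option.some.inj (hlast.symm.trans hz)
        exact ⟨j, hji, hbj⟩
    obtain ⟨k, hkl, c, hc, hrc⟩ := exists_bucket_of_reflTransGen_removeInto hG hdec hord hD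
      hzl (.head hdir hrz) hrX
    obtain rfl := hdec.eq_of_undirReach ha hc (hin.trans hrc)
    exact absurd hli (not_lt.2 hkl)
  · have hG' : G.dir p[r + 1] p[r] := (hD.dir_or_undir hdir.1).resolve_right fun h =>
      hout' (.single (G.undir_symm _ _ h))
    have hra : G.dir p[r + 1] a :=
      hG.dir_of_undirReach hG' (fun h => hout' h.symm) hin.symm
    have hPa : p[r + 1] ∈ G.PaFin (Bs.get i) := by
      refine Finset.mem_sdiff.2 ⟨by simpa using ⟨a, ha, hra⟩, fun h => ?_⟩
      exact hout ((hdec.bucket i).undirReach ha h)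
    by_cases hend : r + 2 < p.length
    · have hnZ := hcon.1 (r + 1) p[r + 1] (by omega) hend (by simp) (by
        rintro ⟨u, v, w, hu, hv, -, -, huv, -⟩
        rw [List.getElem?_eq_some_iff] at hu hv
        obtain ⟨_, rfl⟩ := hu
        obtain ⟨_, rfl⟩ := hv
        exact (D.removeInto X).dir_asymm _ _ hdir huv)
      rw [Finset.mem_union, not_or] at hnZ
      obtain ⟨m, hm⟩ := hdec.exists_mem (mem_AnIn_of_dir hnZ.1 hra haA)
      have hmi : m < i := lt_of_le_of_ne (hord.le_of_dir hm ha hra) (by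
        rintro rfl
        exact hout ((hdec.bucket m).undirReach ha hm))
      exact hnZ.2 (Finset.mem_inter.2 ⟨Finset.mem_foldr_union_take.2 ⟨m, hmi, hm⟩, hPa⟩)
    · have hrb : p[r + 1] = b := by
        rw [← hpl]; congr 1; omega
      exact hbPa (hrb ▸ hPa)
end
end

section
/- Let X and Y be disjoint node sets in an MPDAG G = (V,E). If there is no possibly causal path from X to Y in G, then for every DAG D in [G] and every strictly positive discrete observational density f over V consistent with D, the marginal over Y of the interventional density obtained from f by truncated factorization with respect to D satisfies f(y|do(x)) = f(y) for all values x of X and y of Y. -/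
open scoped Classical

noncomputable section

open PDG

namespace PDG

variable {V : Type}

lemma possiblyCausal_of_inClassOf {G D : PDG V} (hD : D.InClassOf G) {p : List V}
    (hlen : 2 ≤ p.length) (hp : p.IsChain D.dir) : G.PossiblyCausal p := by
  obtain ⟨⟨-, hac⟩, hadj, -, hdir⟩ := hD
  have hpw : p.Pairwise (Relation.TransGen D.dir) :=
    List.isChain_iff_pairwise.mp (hp.imp fun _ _ h => Relation.TransGen.single h)
  refine ⟨⟨hlen, ?_, ?_⟩, ?_⟩
  · refine hpw.imp ?_
    rintro a b h rfl
    exact hac a h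
  · exact hp.imp fun a b h => (hadj a b).mpr (Or.inl h)
  · intro i j hij h
    have h' : Relation.TransGen D.dir (p.get i) (p.get j) := List.pairwise_iff_get.mp hpw i j hij
    exact hac _ (h'.tail (hdir _ _ h))

lemma not_ancestor_of_no_possiblyCausal {G D : PDG V} (hD : D.InClassOf G) {X Y : Finset V}
    (hXY : Disjoint X Y)
    (hno : ¬ ∃ p, G.PossiblyCausal p ∧ (∃ a ∈ X, p.head? = some a) ∧ EndsIn Y p)
    {a b : V} (ha : a ∈ X) (hb : b ∈ Y) : ¬ Relation.ReflTransGen D.dir a b := by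
  intro h
  obtain ⟨l, hl, hlast⟩ := List.exists_isChain_cons_of_relationReflTransGen h
  refine hno ⟨a :: l, possiblyCausal_of_inClassOf hD ?_ hl, ⟨a, ha, rfl⟩, b, hb, ?_⟩
  · cases l with
    | nil =>
      have hab : a = b := by simpa using hlast
      exact absurd hb (hab ▸ Finset.disjoint_left.mp hXY ha)
    | cons c l => simp
  · rw [List.getLast?_eq_some_getLast (List.cons_ne_nil a l), hlast]

/-- In an acyclic graph every nonempty finite set of nodes contains a node all of whose
children lie outside the set. -/
lemma Acyclic.exists_sink {D : PDG V} (hac : D.Acyclic) {S : Finset V} (hS : S.Nonempty) :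
    ∃ u ∈ S, ∀ v ∈ S, ¬ D.dir u v := by
  have : IsStrictOrder V (Relation.TransGen fun a b => D.dir b a) :=
    { irrefl := fun a h => hac a (Relation.transGen_swap.mp h)
      trans := fun _ _ _ => Relation.TransGen.trans }
  obtain ⟨u, hu, hmin⟩ := (S.finite_toSet.wellFoundedOn
    (r := Relation.TransGen fun a b => D.dir b a)).has_min
      (Set.univ : Set (S : Set V)) ⟨⟨_, hS.choose_spec⟩, trivial⟩
  exact ⟨u, u.2, fun v hv h => hmin ⟨v, hv⟩ trivial (Relation.TransGen.single h)⟩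

end PDG

section Density

variable {V : Type} [Fintype V] [DecidableEq V] {Ω : Type} [Fintype Ω] [DecidableEq Ω]

lemma sum_eq_sum_sum_update (K : (V → Ω) → ℝ) (u : V) (a : Ω) :
    ∑ g, K g = ∑ g : V → Ω, if g u = a then ∑ w, K (Function.update g u w) else 0 := by
  rw [← Finset.sum_filter, ← Finset.sum_product']
  refine Finset.sum_nbij' (fun h => (Function.update h u a, h u))
    (fun q => Function.update q.1 u q.2) ?_ ?_ ?_ ?_ ?_
  · simp
  · simp
  · simp
  · rintro ⟨g, w⟩ h
    have hg : g u = a := by simpa using h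
    simp [← hg]
  · simp

lemma margin_congr (f : (V → Ω) → ℝ) {S : Finset V} {g h : V → Ω} (hgh : ∀ v ∈ S, g v = h v) :
    margin f S g = margin f S h := by
  unfold margin
  refine Finset.sum_congr rfl fun k _ => if_congr ?_ rfl rfl
  exact forall₂_congr fun v hv => by rw [hgh v hv]

lemma condOn_congr (f : (V → Ω) → ℝ) {A B : Finset V} {g h : V → Ω}
    (hgh : ∀ v ∈ A ∪ B, g v = h v) : condOn f A B g = condOn f A B h := by
  rw [condOn, condOn, margin_congr f hgh,
    margin_congr f fun v hv => hgh v (Finset.mem_union_right A hv)]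

lemma margin_pos {f : (V → Ω) → ℝ} (hf : ∀ g, 0 < f g) (S : Finset V) (g : V → Ω) :
    0 < margin f S g := by
  refine Finset.sum_pos' (fun h _ => ?_) ⟨g, Finset.mem_univ g, ?_⟩
  · split_ifs
    exacts [(hf h).le, le_rfl]
  · simpa using hf g

lemma sum_margin_update (f : (V → Ω) → ℝ) {S : Finset V} {u : V} (hu : u ∉ S) (g : V → Ω) :
    ∑ w, margin f ({u} ∪ S) (Function.update g u w) = margin f S g := by
  unfold margin
  rw [Finset.sum_comm]
  refine Finset.sum_congr rfl fun h _ => ?_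
  have key (w : Ω) : (∀ v ∈ {u} ∪ S, h v = Function.update g u w v) ↔
      h u = w ∧ ∀ v ∈ S, h v = g v := by
    rw [← Finset.insert_eq, Finset.forall_mem_insert, Function.update_self]
    refine and_congr_right fun _ => forall₂_congr fun v hv => ?_
    rw [Function.update_of_ne (ne_of_mem_of_not_mem hv hu)]
  simp only [key, ite_and, Finset.sum_ite_eq, Finset.mem_univ, if_true]

lemma sum_condOn_update {f : (V → Ω) → ℝ} (hf : ∀ g, 0 < f g) {S : Finset V} {u : V}
    (hu : u ∉ S) (g : V → Ω) : ∑ w, condOn f {u} S (Function.update g u w) = 1 := by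
  have hS (w : Ω) : margin f S (Function.update g u w) = margin f S g :=
    margin_congr f fun v hv => Function.update_of_ne (ne_of_mem_of_not_mem hv hu) _ _
  simp only [condOn, hS]
  rw [← Finset.sum_div, sum_margin_update f hu, div_self (margin_pos hf S g).ne']

/-- The sum of a test function `φ` against the truncated factorization, with the nodes of `X`
fixed at `x`. -/
def truncatedSum (f : (V → Ω) → ℝ) (D : PDG V) (X : Finset V) (x : V → Ω)
    (φ : (V → Ω) → ℝ) : ℝ :=
  ∑ g : V → Ω,
    if ∀ v ∈ X, g v = x v then φ g * ∏ v ∈ Finset.univ \ X, condOn f {v} (D.paFin v) g else 0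

lemma truncatedSum_insert {f : (V → Ω) → ℝ} (hf : ∀ g, 0 < f g) {D : PDG V} {X : Finset V}
    {u : V} (hu : u ∉ X) (hch : ∀ v, D.dir u v → v ∈ X) (x : V → Ω) {φ : (V → Ω) → ℝ}
    (hφ : ∀ g w, φ (Function.update g u w) = φ g) :
    truncatedSum f D (insert u X) x φ = truncatedSum f D X x φ := by
  unfold truncatedSum
  conv_rhs => rw [sum_eq_sum_sum_update _ u (x u)]
  refine Finset.sum_congr rfl fun g _ => ?_
  have hX (w : Ω) : (∀ v ∈ X, Function.update g u w v = x v) ↔ ∀ v ∈ X, g v = x v :=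
    forall₂_congr fun v hv => by rw [Function.update_of_ne (ne_of_mem_of_not_mem hv hu)]
  have hprod (w : Ω) :
      ∏ v ∈ Finset.univ \ X, condOn f {v} (D.paFin v) (Function.update g u w) =
        condOn f {u} (D.paFin u) (Function.update g u w) *
          ∏ v ∈ Finset.univ \ insert u X, condOn f {v} (D.paFin v) g := by
    rw [Finset.sdiff_insert,
      ← Finset.mul_prod_erase (Finset.univ \ X) _ (by simpa using hu : u ∈ Finset.univ \ X)]
    congr 1
    refine Finset.prod_congr rfl fun v hv => condOn_congr f fun t ht => ?_
    refine Function.update_of_ne ?_ _ _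
    rintro rfl
    simp only [Finset.mem_erase, Finset.mem_sdiff, Finset.mem_univ, true_and] at hv
    rcases Finset.mem_union.mp ht with h | h
    · exact hv.1 (Finset.mem_singleton.mp h).symm
    · exact hv.2 (hch v (by simpa [PDG.paFin] using h))
  simp only [Finset.forall_mem_insert, hX, hφ, hprod, ite_and]
  refine if_congr Iff.rfl ?_ rfl
  by_cases h : ∀ v ∈ X, g v = x v
  · simp only [if_pos h]
    rw [← Finset.mul_sum, ← Finset.sum_mul, sum_condOn_update hf, one_mul]
    simpa [PDG.paFin] using D.dir_irrefl u
  · simp only [if_neg h, Finset.sum_const_zero]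

/-- If `φ` depends only on a parent-closed set `A`, then fixing nodes outside `A` does not
change its truncated sum. -/
lemma truncatedSum_eq_compl {f : (V → Ω) → ℝ} (hf : ∀ g, 0 < f g) {D : PDG V}
    (hac : D.Acyclic) {A : Finset V} (hA : ∀ a b, D.dir a b → b ∈ A → a ∈ A)
    (x : V → Ω) {φ : (V → Ω) → ℝ}
    (hφ : ∀ u ∉ A, ∀ g w, φ (Function.update g u w) = φ g) (X : Finset V) (hX : Disjoint X A) :
    truncatedSum f D X x φ = truncatedSum f D Aᶜ x φ := by
  induction hn : (Aᶜ \ X).card generalizing X with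
  | zero =>
    have h1 : Aᶜ ⊆ X := by simpa using hn
    rw [(Finset.subset_compl_iff_disjoint_right.mpr hX).antisymm h1]
  | succ n ih =>
    obtain ⟨u, hu, hmax⟩ := hac.exists_sink (Finset.card_pos.mp (by omega : 0 < (Aᶜ \ X).card))
    obtain ⟨huA, huX⟩ := Finset.mem_sdiff.mp hu
    rw [Finset.mem_compl] at huA
    rw [← truncatedSum_insert hf huX _ x (hφ u huA)]
    · refine ih (insert u X) (Finset.disjoint_insert_left.mpr ⟨huA, hX⟩) ?_
      rw [Finset.sdiff_insert, Finset.card_erase_of_mem hu, hn, Nat.add_sub_cancel]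
    · intro v huv
      by_contra hv
      exact hmax v (by simpa [hv] using fun h => huA (hA u v huv h)) huv

lemma doMargin_eq_truncatedSum (f : (V → Ω) → ℝ) (D : PDG V) (X : Finset V) (x : V → Ω)
    (Y : Finset V) (y : V → Ω) :
    doMargin f D X x Y y =
      truncatedSum f D X x fun g => if ∀ v ∈ Y, g v = y v then 1 else 0 := by
  unfold doMargin truncatedSum doDens
  refine Finset.sum_congr rfl fun g _ => ?_
  by_cases h : ∀ v ∈ X, g v = x v
  · have hg : (fun u => if u ∈ X then x u else g u) = g := by
      ext u
      split_ifs with hu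
      exacts [(h u hu).symm, rfl]
    rw [hg]
    dsimp only
    by_cases h' : ∀ v ∈ Y, g v = y v
    · rw [if_pos ⟨h, h'⟩, if_pos h, if_pos h', one_mul]
    · rw [if_neg fun k => h' k.2, if_pos h, if_neg h', zero_mul]
  · rw [if_neg fun k => h k.1, if_neg h]

lemma margin_eq_truncatedSum {f : (V → Ω) → ℝ} {D : PDG V} (hcons : ConsistentWith f D)
    (x : V → Ω) (Y : Finset V) (y : V → Ω) :
    margin f Y y = truncatedSum f D ∅ x fun g => if ∀ v ∈ Y, g v = y v then 1 else 0 := by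
  unfold margin truncatedSum
  refine Finset.sum_congr rfl fun g _ => ?_
  rw [Finset.sdiff_empty, ← hcons g, ite_mul, one_mul, zero_mul]
  simp

end Density

/-- if there is no possibly causal path from `X` to `Y` in `G`, then
`f(y | do(x)) = f(y)`. -/
theorem stmt14 {V : Type} [Fintype V] [DecidableEq V]
    {Ω : Type} [Fintype Ω] [DecidableEq Ω]
    (G : PDG V) (hG : G.IsMPDAG) (X Y : Finset V) (hXY : Disjoint X Y)
    (hno : ¬ ∃ p, G.PossiblyCausal p ∧ (∃ a ∈ X, p.head? = some a) ∧ EndsIn Y p)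
    (D : PDG V) (hD : D.InClassOf G)
    (f : (V → Ω) → ℝ) (hf : IsPosDensity f) (hcons : ConsistentWith f D)
    (x y : V → Ω) :
    doMargin f D X x Y y = margin f Y y := by
  let A : Finset V := Finset.univ.filter fun a => ∃ b ∈ Y, Relation.ReflTransGen D.dir a b
  have hA : ∀ a b, D.dir a b → b ∈ A → a ∈ A := by
    intro a b hab hb
    simp only [A, Finset.mem_filter, Finset.mem_univ, true_and] at hb ⊢
    obtain ⟨c, hc, hbc⟩ := hb
    exact ⟨c, hc, hbc.head hab⟩
  have hYA : ∀ v ∈ Y, v ∈ A := fun v hv => by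
    simpa [A] using ⟨v, hv, Relation.ReflTransGen.refl⟩
  have hXA : Disjoint X A := by
    rw [Finset.disjoint_left]
    intro a ha haA
    simp only [A, Finset.mem_filter, Finset.mem_univ, true_and] at haA
    obtain ⟨b, hb, hab⟩ := haA
    exact not_ancestor_of_no_possiblyCausal hD hXY hno ha hb hab
  have hφ : ∀ u ∉ A, ∀ (g : V → Ω) (w : Ω),
      (if ∀ v ∈ Y, Function.update g u w v = y v then (1 : ℝ) else 0) =
        if ∀ v ∈ Y, g v = y v then 1 else 0 := by
    intro u hu g w
    refine if_congr (forall₂_congr fun v hv => ?_) rfl rfl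
    rw [Function.update_of_ne (ne_of_mem_of_not_mem (hYA v hv) hu)]
  rw [doMargin_eq_truncatedSum, margin_eq_truncatedSum hcons x,
    truncatedSum_eq_compl hf.1 hD.1.2 hA x hφ X hXA,
    truncatedSum_eq_compl hf.1 hD.1.2 hA x hφ ∅ (Finset.disjoint_empty_left A)]
end
end
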